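/- Suppose n = p + q ≥ 2 and let k ≥ 1. The operator P ↦ F·Δ(P) maps the (finite-dimensional) space of homogeneous polynomials of degree k in ℝ[X₁,…,Xₙ] to itself, and its minimal polynomial on this space is exactly ∏_{s=0}^{⌊k/2⌋}(x − b_{k,s}); in particular its spectrum is {b_{k,s} : 0 ≤ s ≤ ⌊k/2⌋}, these values are pairwise distinct, and the operator is diagonalizable. (Purely even, positive-superdimension case of the minimal polynomial theorem for the Casimir operator.) -/

import Mathlib

open MvPolynomial

/-- Signature: `ε_i = 1` for `i < p` (1-based: `i ≤ p`), `ε_i = -1` otherwise. -/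
noncomputable def sgn (p : ℕ) {n : ℕ} (i : Fin n) : ℝ := if (i : ℕ) < p then 1 else -1

/-- `F = ∑ ε_i X_i²`. -/
noncomputable def Fquad (p q : ℕ) : MvPolynomial (Fin (p + q)) ℝ :=
  ∑ i, C (sgn p i) * X i ^ 2

/-- The Laplacian of signature `(p,q)`: `Δ = ∑ ε_i ∂²/∂X_i²`. -/
noncomputable def lap (p q : ℕ) (P : MvPolynomial (Fin (p + q)) ℝ) :
    MvPolynomial (Fin (p + q)) ℝ :=
  ∑ i, C (sgn p i) * pderiv i (pderiv i P)

/-- `b_{k,s} = 2s(n + 2(k - s - 1))` with `n = p + q`. -/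
noncomputable def bCoef (n k s : ℕ) : ℝ :=
  2 * (s : ℝ) * ((n : ℝ) + 2 * ((k : ℝ) - (s : ℝ) - 1))


namespace FMulLapAux

lemma sgn_sq (p : ℕ) {n : ℕ} (i : Fin n) : sgn p i * sgn p i = 1 := by
  unfold sgn; split_ifs <;> norm_num

/-- The Laplacian as a linear map. -/
noncomputable def lapL (p q : ℕ) :
    MvPolynomial (Fin (p + q)) ℝ →ₗ[ℝ] MvPolynomial (Fin (p + q)) ℝ :=
  ∑ i, (LinearMap.mulLeft ℝ (C (sgn p i))) ∘ₗ
    ((pderiv i).toLinearMap ∘ₗ (pderiv i).toLinearMap)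

lemma lapL_apply (p q : ℕ) (P : MvPolynomial (Fin (p + q)) ℝ) : lapL p q P = lap p q P := by
  simp [lapL, lap, LinearMap.sum_apply]

/-- Laplacian followed by multiplication by `F`. -/
noncomputable def T (p q : ℕ) : Module.End ℝ (MvPolynomial (Fin (p + q)) ℝ) :=
  LinearMap.mulLeft ℝ (Fquad p q) ∘ₗ lapL p q

lemma T_apply (p q : ℕ) (P : MvPolynomial (Fin (p + q)) ℝ) :
    T p q P = Fquad p q * lap p q P := by
  simp [T, lapL_apply]

lemma pderiv_F (p q : ℕ) (i : Fin (p + q)) :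
    pderiv i (Fquad p q) = C (sgn p i) * (2 * X i) := by
  unfold Fquad
  rw [map_sum, Finset.sum_eq_single i]
  · simp [Derivation.leibniz, Derivation.leibniz_pow, pderiv_X_self]
    try ring
  · intro j _ hj
    simp [Derivation.leibniz, Derivation.leibniz_pow, pderiv_X_of_ne hj]
  · simp

lemma lap_F_mul (p q k : ℕ) (P : MvPolynomial (Fin (p + q)) ℝ) (hP : P.IsHomogeneous k) :
    lap p q (Fquad p q * P) =
      Fquad p q * lap p q P + (2 * ((p + q : ℕ) : ℝ) + 4 * (k : ℝ)) • P := by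
  have key : ∀ i : Fin (p + q), C (sgn p i) * pderiv i (pderiv i (Fquad p q * P)) =
      Fquad p q * (C (sgn p i) * pderiv i (pderiv i P)) + (2 * P + 4 * (X i * pderiv i P)) := by
    intro i
    have h1 : (C (sgn p i) * C (sgn p i) : MvPolynomial (Fin (p + q)) ℝ) = 1 := by
      rw [← C_mul, sgn_sq, C_1]
    have h2 : pderiv i (2 : MvPolynomial (Fin (p + q)) ℝ) = 0 := by
      have := (pderiv (R := ℝ) i).map_natCast 2
      simpa using this
    simp only [pderiv_mul, pderiv_F, map_add, pderiv_C, pderiv_X_self, h2]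
    linear_combination (2 * P + 4 * (X i * pderiv i P)) * h1
  have he := hP.sum_X_mul_pderiv
  unfold lap
  rw [Finset.sum_congr rfl (fun i _ => key i), Finset.sum_add_distrib, Finset.sum_add_distrib,
    ← Finset.mul_sum, ← Finset.mul_sum, ← Finset.mul_sum, he]
  simp only [Finset.sum_const, Finset.card_univ, Fintype.card_fin, nsmul_eq_mul, smul_eq_C_mul,
    map_add, map_mul, map_natCast, map_ofNat]
  ring

lemma F_hom (p q : ℕ) : (Fquad p q).IsHomogeneous 2 := by
  unfold Fquad
  apply IsHomogeneous.sum
  intro i _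
  simpa using (isHomogeneous_C _ (sgn p i)).mul ((isHomogeneous_X ℝ i).pow 2)

lemma lap_hom (p q k : ℕ) (P : MvPolynomial (Fin (p + q)) ℝ) (hP : P.IsHomogeneous k) :
    (lap p q P).IsHomogeneous (k - 2) := by
  unfold lap
  apply IsHomogeneous.sum
  intro i _
  have := (isHomogeneous_C _ (sgn p i)).mul ((hP.pderiv (i := i)).pderiv (i := i))
  simpa [Nat.sub_sub] using this

lemma lap_eq_zero (p q k : ℕ) (hk : k < 2) (P : MvPolynomial (Fin (p + q)) ℝ)
    (hP : P.IsHomogeneous k) : lap p q P = 0 := by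
  unfold lap
  apply Finset.sum_eq_zero
  intro i _
  have h := hP.pderiv (i := i)
  rw [show k - 1 = 0 by omega] at h
  rw [← totalDegree_zero_iff_isHomogeneous, totalDegree_eq_zero_iff_eq_C] at h
  rw [h, pderiv_C, mul_zero]

lemma T_hom (p q k : ℕ) (P : MvPolynomial (Fin (p + q)) ℝ) (hP : P.IsHomogeneous k) :
    (Fquad p q * lap p q P).IsHomogeneous k := by
  by_cases hk : k < 2
  · rw [lap_eq_zero p q k hk P hP, mul_zero]; exact isHomogeneous_zero _ _ _
  · have := (F_hom p q).mul (lap_hom p q k P hP)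
    rwa [show 2 + (k - 2) = k by omega] at this

lemma bCoef_succ (n k s : ℕ) :
    bCoef n (k + 2) (s + 1) = bCoef n k s + (2 * (n : ℝ) + 4 * (k : ℝ)) := by
  unfold bCoef; push_cast; ring

lemma bCoef_zero (n k : ℕ) : bCoef n k 0 = 0 := by simp [bCoef]

lemma aeval_prod_hom (p q k m : ℕ) (b : ℕ → ℝ) (P : MvPolynomial (Fin (p + q)) ℝ)
    (hP : P.IsHomogeneous k) :
    (Polynomial.aeval (T p q) (∏ s ∈ Finset.range m, (Polynomial.X - Polynomial.C (b s)))
      P).IsHomogeneous k := by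
  induction m with
  | zero => simpa using hP
  | succ m ih =>
    rw [Finset.prod_range_succ, mul_comm, map_mul, Module.End.mul_apply]
    set Q := Polynomial.aeval (T p q)
      (∏ s ∈ Finset.range m, (Polynomial.X - Polynomial.C (b s))) P
    have h1 := T_hom p q k Q ih
    simp only [map_sub, Polynomial.aeval_X, Polynomial.aeval_C, LinearMap.sub_apply, T_apply,
      Module.algebraMap_end_apply]
    exact (homogeneousSubmodule (Fin (p + q)) ℝ k).sub_mem h1
      ((homogeneousSubmodule (Fin (p + q)) ℝ k).smul_mem _ ih)

lemma aeval_prod_F_mul (p q k m : ℕ) (P : MvPolynomial (Fin (p + q)) ℝ)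
    (hP : P.IsHomogeneous k) :
    Polynomial.aeval (T p q) (∏ s ∈ Finset.range m,
        (Polynomial.X - Polynomial.C (bCoef (p + q) (k + 2) (s + 1)))) (Fquad p q * P) =
      Fquad p q * Polynomial.aeval (T p q) (∏ s ∈ Finset.range m,
        (Polynomial.X - Polynomial.C (bCoef (p + q) k s))) P := by
  induction m with
  | zero => simp
  | succ m ih =>
    rw [Finset.prod_range_succ, Finset.prod_range_succ,
      mul_comm (∏ s ∈ Finset.range m, (Polynomial.X - Polynomial.C (bCoef (p + q) k s))),
      mul_comm (∏ s ∈ Finset.range m,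
        (Polynomial.X - Polynomial.C (bCoef (p + q) (k + 2) (s + 1)))),
      Polynomial.aeval_mul, Polynomial.aeval_mul, Module.End.mul_apply, Module.End.mul_apply, ih]
    have hQ := aeval_prod_hom p q k m (bCoef (p + q) k) P hP
    set Q := Polynomial.aeval (T p q)
      (∏ s ∈ Finset.range m, (Polynomial.X - Polynomial.C (bCoef (p + q) k s))) P
    simp only [map_sub, Polynomial.aeval_X, Polynomial.aeval_C, LinearMap.sub_apply, T_apply,
      Module.algebraMap_end_apply, lap_F_mul p q k Q hQ, bCoef_succ]
    simp only [smul_eq_C_mul, map_add]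
    ring

lemma annihilate (p q k : ℕ) : ∀ P : MvPolynomial (Fin (p + q)) ℝ, P.IsHomogeneous k →
    Polynomial.aeval (T p q) (∏ s ∈ Finset.range (k / 2 + 1),
        (Polynomial.X - Polynomial.C (bCoef (p + q) k s))) P = 0 := by
  induction k using Nat.strong_induction_on with
  | _ k ih =>
    intro P hP
    by_cases hk : k < 2
    · rw [show k / 2 = 0 by omega]
      simp [bCoef_zero, T_apply, lap_eq_zero p q k hk P hP]
    · obtain ⟨j, rfl⟩ : ∃ j, k = j + 2 := ⟨k - 2, by omega⟩
      rw [show (j + 2) / 2 = j / 2 + 1 by omega, Finset.prod_range_succ', map_mul,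
        Module.End.mul_apply]
      have h1 : Polynomial.aeval (T p q)
          (Polynomial.X - Polynomial.C (bCoef (p + q) (j + 2) 0)) P =
          Fquad p q * lap p q P := by
        simp [bCoef_zero, T_apply]
      have hl := lap_hom p q _ P hP
      rw [Nat.add_sub_cancel] at hl
      rw [h1, aeval_prod_F_mul p q j _ _ hl, ih j (by omega) _ hl, mul_zero]

lemma F_ne_zero (p q : ℕ) (hn : 2 ≤ p + q) : Fquad p q ≠ 0 := by
  intro h
  have h1 := pderiv_F p q ⟨0, by omega⟩
  rw [h, map_zero] at h1
  have h2 := congrArg (eval (fun _ => (1 : ℝ))) h1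
  have h3 := sgn_sq p (⟨0, by omega⟩ : Fin (p + q))
  simp at h2
  rw [h2] at h3
  simp at h3

lemma not_F_dvd (p q : ℕ) (hn : 2 ≤ p + q) (k : ℕ) (Q : MvPolynomial (Fin (p + q)) ℝ) :
    Fquad p q * Q ≠ X ⟨0, by omega⟩ ^ k := by
  intro h
  set i0 : Fin (p + q) := ⟨0, by omega⟩
  set i1 : Fin (p + q) := ⟨1, by omega⟩
  have h01 : i1 ≠ i0 := by simp [i0, i1]
  obtain ⟨z, hz⟩ := IsAlgClosed.exists_pow_nat_eq
    (-((sgn p i0 : ℝ) : ℂ) * ((sgn p i1 : ℝ) : ℂ)) (n := 2) (by norm_num)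
  let v : Fin (p + q) → ℂ := fun i => if i = i0 then 1 else if i = i1 then z else 0
  have hF : aeval v (Fquad p q) = 0 := by
    unfold Fquad
    rw [map_sum, ← Finset.sum_subset (Finset.subset_univ {i0, i1}), Finset.sum_pair h01.symm]
    · have h1 : ((sgn p i1 : ℝ) : ℂ) * ((sgn p i1 : ℝ) : ℂ) = 1 := by
        exact_mod_cast sgn_sq p i1
      simp [v, h01, hz]
      linear_combination (-((sgn p i0 : ℝ) : ℂ)) * h1
    · intro i _ hi
      simp only [Finset.mem_insert, Finset.mem_singleton, not_or] at hi
      simp [v, hi.1, hi.2]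
  have h2 := congrArg (aeval v) h
  simp [hF, v] at h2

lemma exists_harmonic (p q : ℕ) (hn : 2 ≤ p + q) (k : ℕ) :
    ∃ P : MvPolynomial (Fin (p + q)) ℝ, P ≠ 0 ∧ P.IsHomogeneous k ∧
      Fquad p q * lap p q P = 0 := by
  by_contra! hcon
  have hfin : Module.Finite ℝ (homogeneousSubmodule (Fin (p + q)) ℝ k) :=
    Module.Finite.iff_fg.mpr (homogeneousSubmodule_fg _ _ k)
  let L : Module.End ℝ (homogeneousSubmodule (Fin (p + q)) ℝ k) :=
    (T p q).restrict (fun P hP => by rw [T_apply]; exact T_hom p q k P hP)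
  have hL : ∀ P, ((L P : homogeneousSubmodule (Fin (p + q)) ℝ k) :
      MvPolynomial (Fin (p + q)) ℝ) = Fquad p q * lap p q P := fun P => T_apply p q P
  have hinj : Function.Injective L := by
    rw [← LinearMap.ker_eq_bot, LinearMap.ker_eq_bot']
    intro P hP
    by_contra h0
    exact hcon P (fun h => h0 (Subtype.ext h)) P.2 (by rw [← hL, hP, ZeroMemClass.coe_zero])
  obtain ⟨P, hP⟩ := LinearMap.injective_iff_surjective.mp hinj
    ⟨X (⟨0, by omega⟩ : Fin (p + q)) ^ k, by simpa using (isHomogeneous_X ℝ (⟨0, by omega⟩ : Fin (p + q))).pow k⟩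
  have := congrArg Subtype.val hP
  rw [hL] at this
  exact not_F_dvd p q hn k _ this

lemma exists_eigen (p q : ℕ) (hn : 2 ≤ p + q) (s : ℕ) : ∀ k, s ≤ k / 2 →
    ∃ P : MvPolynomial (Fin (p + q)) ℝ, P ≠ 0 ∧ P.IsHomogeneous k ∧
      Fquad p q * lap p q P = bCoef (p + q) k s • P := by
  induction s with
  | zero =>
    intro k _
    simpa [bCoef_zero] using exists_harmonic p q hn k
  | succ s ih =>
    intro k hk
    obtain ⟨j, rfl⟩ : ∃ j, k = j + 2 := ⟨k - 2, by omega⟩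
    obtain ⟨P, h0, hP, hE⟩ := ih j (by omega)
    refine ⟨Fquad p q * P, mul_ne_zero (F_ne_zero p q hn) h0, ?_, ?_⟩
    · rw [add_comm j 2]; exact (F_hom p q).mul hP
    · rw [lap_F_mul p q j P hP, hE, bCoef_succ]
      simp only [smul_eq_C_mul, map_add]
      ring

lemma bCoef_inj (n k : ℕ) (hn : 2 ≤ n) (s s' : ℕ) (hs : s ≤ k / 2) (hs' : s' ≤ k / 2)
    (h : bCoef n k s = bCoef n k s') : s = s' := by
  unfold bCoef at h
  by_contra hne
  have hprod : ((s : ℝ) - s') * (n + 2 * (k - s - s' - 1)) = 0 := by linear_combination h / 2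
  rcases mul_eq_zero.mp hprod with h1 | h1
  · exact hne (by exact_mod_cast sub_eq_zero.mp h1)
  · have h2 : n + 2 * k = 2 * s + 2 * s' + 2 := by
      have : (n : ℝ) + 2 * k = 2 * s + 2 * s' + 2 := by linear_combination h1
      exact_mod_cast this
    omega

lemma ker_le {V : Type*} [AddCommGroup V] [Module ℝ V] (L : Module.End ℝ V) (b : ℕ → ℝ) (m : ℕ)
    (hb : ∀ s < m, ∀ s' < m, b s = b s' → s = s') :
    LinearMap.ker (Polynomial.aeval L
      (∏ s ∈ Finset.range m, (Polynomial.X - Polynomial.C (b s)))) ≤ ⨆ μ : ℝ, L.eigenspace μ := by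
  induction m with
  | zero => simp [Module.End.one_eq_id]
  | succ m ih =>
    rw [Finset.prod_range_succ, ← Polynomial.sup_ker_aeval_eq_ker_aeval_mul_of_coprime]
    · refine sup_le (ih fun s hs s' hs' => hb s (by omega) s' (by omega)) ?_
      refine le_trans ?_ (le_iSup (fun μ => L.eigenspace μ) (b m))
      intro x hx
      rw [Module.End.mem_eigenspace_iff]
      simpa [sub_eq_zero] using hx
    · apply IsCoprime.prod_left
      intro s hs
      have hs := Finset.mem_range.mp hs
      apply Polynomial.isCoprime_X_sub_C_of_isUnit_sub
      rw [isUnit_iff_ne_zero, sub_ne_zero]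
      intro h
      have := hb s (by omega) m (by omega) h
      omega

end FMulLapAux

/-- For `n = p + q ≥ 2` and `k ≥ 1`, the operator `P ↦ F·Δ(P)` preserves the space of
homogeneous polynomials of degree `k`; any linear endomorphism `L` of that space given
by this formula has minimal polynomial `∏_{s=0}^{⌊k/2⌋} (x - b_{k,s})`, spectrum
`{b_{k,s} : 0 ≤ s ≤ ⌊k/2⌋}` with pairwise distinct values `b_{k,s}`, and is
diagonalizable. -/
theorem minpoly_FMulLap (p q : ℕ) (hn : 2 ≤ p + q) (k : ℕ) (hk : 1 ≤ k) :
    (∀ P ∈ homogeneousSubmodule (Fin (p + q)) ℝ k,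
        Fquad p q * lap p q P ∈ homogeneousSubmodule (Fin (p + q)) ℝ k) ∧
    ∀ L : Module.End ℝ (homogeneousSubmodule (Fin (p + q)) ℝ k),
      (∀ P : homogeneousSubmodule (Fin (p + q)) ℝ k,
          (L P : MvPolynomial (Fin (p + q)) ℝ) = Fquad p q * lap p q (P : MvPolynomial (Fin (p + q)) ℝ)) →
      minpoly ℝ L =
          ∏ s ∈ Finset.range (k / 2 + 1), (Polynomial.X - Polynomial.C (bCoef (p + q) k s)) ∧
        spectrum ℝ L = {x : ℝ | ∃ s ≤ k / 2, bCoef (p + q) k s = x} ∧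
        (∀ s ≤ k / 2, ∀ s' ≤ k / 2, bCoef (p + q) k s = bCoef (p + q) k s' → s = s') ∧
        ⨆ μ : ℝ, L.eigenspace μ = ⊤ := by
  refine ⟨fun P hP => FMulLapAux.T_hom p q k P hP, fun L hL => ?_⟩
  have hfin : Module.Finite ℝ (homogeneousSubmodule (Fin (p + q)) ℝ k) :=
    Module.Finite.iff_fg.mpr (homogeneousSubmodule_fg _ _ k)
  have hinj : ∀ s ≤ k / 2, ∀ s' ≤ k / 2, bCoef (p + q) k s = bCoef (p + q) k s' → s = s' :=
    fun s hs s' hs' h => FMulLapAux.bCoef_inj (p + q) k hn s s' hs hs' h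
  have hcomp : ∀ (f : Polynomial ℝ) (P : homogeneousSubmodule (Fin (p + q)) ℝ k),
      ((Polynomial.aeval L f P : homogeneousSubmodule (Fin (p + q)) ℝ k) :
        MvPolynomial (Fin (p + q)) ℝ) = Polynomial.aeval (FMulLapAux.T p q) f P := by
    intro f
    induction f using Polynomial.induction_on with
    | C a => intro P; simp [Module.algebraMap_end_apply]
    | add f g hf hg => intro P; simp [hf, hg]
    | monomial n a h =>
      intro P
      have := h (L P)
      rw [hL, ← FMulLapAux.T_apply] at this
      rw [pow_succ, ← mul_assoc, Polynomial.aeval_mul (x := L),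
        Polynomial.aeval_mul (x := FMulLapAux.T p q), Module.End.mul_apply, Module.End.mul_apply,
        Polynomial.aeval_X, Polynomial.aeval_X, this]
  have hann : Polynomial.aeval L (∏ s ∈ Finset.range (k / 2 + 1),
      (Polynomial.X - Polynomial.C (bCoef (p + q) k s))) = 0 := by
    ext1 P
    apply Subtype.ext
    rw [hcomp, FMulLapAux.annihilate p q k P P.2]
    rfl
  have heig : ∀ s ≤ k / 2, L.HasEigenvalue (bCoef (p + q) k s) := by
    intro s hs
    obtain ⟨P, h0, hP, hE⟩ := FMulLapAux.exists_eigen p q hn s k hs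
    refine Module.End.hasEigenvalue_of_hasEigenvector (x := ⟨P, hP⟩)
      ⟨Module.End.mem_eigenspace_iff.mpr (Subtype.ext ?_), fun h => h0 (congrArg Subtype.val h)⟩
    rw [hL]
    exact hE
  have hmin : minpoly ℝ L =
      ∏ s ∈ Finset.range (k / 2 + 1), (Polynomial.X - Polynomial.C (bCoef (p + q) k s)) := by
    apply Polynomial.eq_of_monic_of_associated
      (minpoly.monic (Algebra.IsIntegral.isIntegral L))
      (Polynomial.monic_prod_of_monic _ _ fun s _ => Polynomial.monic_X_sub_C _)
    apply associated_of_dvd_dvd (minpoly.dvd ℝ L hann)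
    apply Finset.prod_dvd_of_coprime
    · intro s hs s' hs' hne
      apply Polynomial.isCoprime_X_sub_C_of_isUnit_sub
      rw [isUnit_iff_ne_zero, sub_ne_zero]
      intro h
      have h1 := Finset.mem_range.mp hs
      have h2 := Finset.mem_range.mp hs'
      exact hne (hinj s (by omega) s' (by omega) h)
    · intro s hs
      have h1 := Finset.mem_range.mp hs
      exact Polynomial.dvd_iff_isRoot.mpr
        (Module.End.isRoot_of_hasEigenvalue (heig s (by omega)))
  refine ⟨hmin, ?_, hinj, ?_⟩
  · ext x
    rw [← Module.End.hasEigenvalue_iff_mem_spectrum, Module.End.hasEigenvalue_iff_isRoot, hmin,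
      Polynomial.IsRoot.def, Polynomial.eval_prod, Finset.prod_eq_zero_iff]
    constructor
    · rintro ⟨s, hs, h⟩
      have h1 := Finset.mem_range.mp hs
      refine ⟨s, by omega, ?_⟩
      simp only [Polynomial.eval_sub, Polynomial.eval_X, Polynomial.eval_C] at h
      linarith
    · rintro ⟨s, hs, rfl⟩
      exact ⟨s, Finset.mem_range.mpr (by omega), by simp⟩
  · rw [eq_top_iff]
    have := FMulLapAux.ker_le L (bCoef (p + q) k) (k / 2 + 1)
      (fun s hs s' hs' h => hinj s (by omega) s' (by omega) h)
    rwa [hann, LinearMap.ker_zero] at this
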